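/- Let P ∈ ℤ[[z_1,…,z_n]] and let β_1,…,β_n ∈ ℤ^n be ℤ-linearly independent weights. If 1 − V_{β_j} divides P in ℤ[[z_1,…,z_n]] for every j = 1,…,n, then the product (1 − V_{β_1})⋯(1 − V_{β_n}) divides P in ℤ[[z_1,…,z_n]]. -/

import Mathlib

/-!
STATEMENT 8: Let `P ∈ ℤ[[z₁,…,z_n]]` and let `β₁,…,β_n ∈ ℤⁿ` be ℤ-linearly independent weights.
If `1 − V_{βⱼ}` divides `P` in `ℤ[[z₁,…,z_n]]` for every `j = 1,…,n`, then the product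
`(1 − V_{β₁})⋯(1 − V_{β_n})` divides `P` in `ℤ[[z₁,…,z_n]]`.

Here `V_a := Πᵢ (1+zᵢ)^{aᵢ}` (a unit of `ℤ[[z₁,…,z_n]]`, with negative exponents taken via the
inverse of the unit `1+zᵢ`), so `1 − V_a` is the K-theoretic Euler class of the weight `a`.
-/

namespace TMB

/-- The completed representation ring `K⁰(BTⁿ)`, modelled as `ℤ[[z₁,…,z_n]]`. -/
abbrev PS (n : ℕ) := MvPowerSeries (Fin n) ℤ

/-- The unit `1 + zᵢ` of `ℤ[[z₁,…,z_n]]`. -/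
noncomputable def onePlusZ {n : ℕ} (i : Fin n) : (PS n)ˣ :=
  Units.mkOfMulEqOne (1 + MvPowerSeries.X i)
    (MvPowerSeries.invOfUnit (1 + MvPowerSeries.X i) 1)
    (MvPowerSeries.mul_invOfUnit _ _ (by simp))

/-- The (class of the) 1-dimensional representation of weight `a ∈ ℤⁿ`:
`V_a = Πᵢ (1+zᵢ)^{aᵢ}` (with negative exponents taken via the inverse of the unit `1+zᵢ`). -/
noncomputable def Vwt {n : ℕ} (a : Fin n → ℤ) : PS n :=
  ((∏ i, onePlusZ i ^ a i : (PS n)ˣ) : PS n)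

/-- The Koszul complex of the pair `a, b` is exact in the middle: every relation `a * s = b * q`
is a multiple of the trivial one. -/
def KoszulExact {R : Type*} [CommRing R] (a b : R) : Prop :=
  ∀ s q : R, a * s = b * q → ∃ t, s = b * t ∧ q = a * t

namespace KoszulExact

variable {R : Type*} [CommRing R] {a a' b : R}

lemma symm (h : KoszulExact a b) : KoszulExact b a := fun s q hsq ↦
  let ⟨t, hq, hs⟩ := h q s hsq.symm
  ⟨t, hs, hq⟩

lemma mul_left (h : KoszulExact a b) (h' : KoszulExact a' b) : KoszulExact (a * a') b := by
  intro s q hsq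
  obtain ⟨t, ht, rfl⟩ := h (a' * s) q (by rw [← hsq, mul_assoc])
  obtain ⟨t', rfl, rfl⟩ := h' s t ht
  exact ⟨t', rfl, (mul_assoc _ _ _).symm⟩

lemma neg_left (h : KoszulExact a b) : KoszulExact (-a) b := by
  intro s q hsq
  obtain ⟨t, ht, rfl⟩ := h (-s) q (by rw [← hsq]; ring)
  exact ⟨-t, by rw [mul_neg, ← ht, neg_neg], by ring⟩

lemma one_left (b : R) : KoszulExact 1 b := fun s q hsq ↦ ⟨q, by simpa using hsq, by simp⟩

lemma dvd_of_dvd_mul (h : KoszulExact a b) {q : R} (hq : a ∣ b * q) : a ∣ q := by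
  obtain ⟨s, hs⟩ := hq
  obtain ⟨t, -, rfl⟩ := h s q hs.symm
  exact Dvd.intro _ rfl

lemma of_dvd [IsDomain R] (ha : a ≠ 0) (h : ∀ q, a ∣ b * q → a ∣ q) : KoszulExact a b := by
  intro s q hsq
  obtain ⟨t, rfl⟩ := h q (Dvd.intro s hsq)
  exact ⟨t, mul_left_cancel₀ ha (by rw [hsq]; ring), rfl⟩

lemma of_prime [IsDomain R] (ha : Prime a) (hab : ¬ a ∣ b) : KoszulExact a b :=
  of_dvd ha.ne_zero fun _ hq ↦ (ha.dvd_or_dvd hq).resolve_left hab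

lemma left_ne_zero (h : KoszulExact a b) (hb : ¬ IsUnit b) : a ≠ 0 := by
  rintro rfl
  obtain ⟨t, ht, -⟩ := h 1 0 (by simp)
  exact hb (IsUnit.of_mul_eq_one t ht.symm)

end KoszulExact

/-- Divisors that are pairwise non-zero-divisors modulo each other can be divided out
simultaneously. -/
lemma prod_dvd_of_pairwise_dvd_of_dvd_mul {R ι : Type*} [CommRing R] (s : Finset ι) (f : ι → R)
    (hf : ∀ i ∈ s, ∀ j ∈ s, i ≠ j → ∀ q, f i ∣ f j * q → f i ∣ q) :
    ∀ p, (∀ i ∈ s, f i ∣ p) → ∏ i ∈ s, f i ∣ p := by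
  classical
  induction s using Finset.induction_on with
  | empty => simp
  | insert a s has ih =>
    intro p hp
    obtain ⟨q, rfl⟩ := hp a (Finset.mem_insert_self a s)
    rw [Finset.prod_insert has]
    refine mul_dvd_mul_left _ (ih (fun i hi j hj ↦ hf i (Finset.mem_insert_of_mem hi) j
      (Finset.mem_insert_of_mem hj)) q fun i hi ↦ ?_)
    exact hf i (Finset.mem_insert_of_mem hi) a (Finset.mem_insert_self a s)
      (fun h ↦ has (h ▸ hi)) q (hp i (Finset.mem_insert_of_mem hi))

section MvPowerSeries

open MvPowerSeries

variable {σ R : Type*} [CommRing R]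

instance [IsDomain R] : IsDomain (MvPowerSeries σ R) := NoZeroDivisors.to_isDomain _

lemma exists_coeff_eq (F : (σ →₀ ℕ) → R) : ∃ f : MvPowerSeries σ R, ∀ d, coeff d f = F d :=
  ⟨F, fun _ ↦ rfl⟩

open Classical in
/-- The part of a power series not involving the variable `X k`. -/
noncomputable def killVarFun (k : σ) (f : MvPowerSeries σ R) : MvPowerSeries σ R :=
  fun d ↦ if d k = 0 then coeff d f else 0

open Classical in
lemma coeff_killVarFun (k : σ) (d : σ →₀ ℕ) (f : MvPowerSeries σ R) :
    coeff d (killVarFun k f) = if d k = 0 then coeff d f else 0 := rfl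

/-- The endomorphism of a power series ring setting the variable `X k` to zero. -/
noncomputable def killVar (k : σ) : MvPowerSeries σ R →+* MvPowerSeries σ R where
  toFun := killVarFun k
  map_one' := by
    classical
    ext d
    rw [coeff_killVarFun, coeff_one]
    split_ifs <;> simp_all
  map_mul' f g := by
    classical
    ext d
    rw [coeff_killVarFun, coeff_mul, coeff_mul]
    simp only [coeff_killVarFun]
    split_ifs with hd
    · refine Finset.sum_congr rfl fun p hp ↦ ?_
      have h := DFunLike.congr_fun (Finset.HasAntidiagonal.mem_antidiagonal.mp hp) k
      rw [Finsupp.add_apply, hd] at h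
      rw [if_pos (by omega), if_pos (by omega)]
    · refine (Finset.sum_eq_zero fun p hp ↦ ?_).symm
      have h := DFunLike.congr_fun (Finset.HasAntidiagonal.mem_antidiagonal.mp hp) k
      rw [Finsupp.add_apply] at h
      by_cases h1 : p.1 k = 0
      · rw [if_neg (c := p.2 k = 0) (by omega), mul_zero]
      · rw [if_neg h1, zero_mul]
  map_zero' := by
    ext d
    simp [coeff_killVarFun]
  map_add' f g := by
    ext d
    simp only [coeff_killVarFun, map_add]
    split_ifs <;> simp

open Classical in
lemma coeff_killVar (k : σ) (d : σ →₀ ℕ) (f : MvPowerSeries σ R) :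
    coeff d (killVar k f) = if d k = 0 then coeff d f else 0 := rfl

lemma killVar_X_self (k : σ) : killVar k (X k : MvPowerSeries σ R) = 0 := by
  classical
  ext d
  rw [coeff_killVar, coeff_X]
  split_ifs <;> simp_all

lemma killVar_X_of_ne {k i : σ} (h : i ≠ k) : killVar k (X i : MvPowerSeries σ R) = X i := by
  classical
  ext d
  rw [coeff_killVar, coeff_X]
  split_ifs <;> simp_all

lemma X_dvd_sub_killVar (k : σ) (f : MvPowerSeries σ R) : X k ∣ f - killVar k f := by
  rw [X_dvd_iff]
  intro m hm
  rw [map_sub, coeff_killVar, if_pos hm, sub_self]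

lemma X_dvd_iff_killVar_eq_zero {k : σ} {f : MvPowerSeries σ R} : X k ∣ f ↔ killVar k f = 0 := by
  constructor
  · rintro ⟨g, rfl⟩
    rw [map_mul, killVar_X_self, zero_mul]
  · intro h
    simpa [h] using X_dvd_sub_killVar k f

lemma prime_X [IsDomain R] (k : σ) : Prime (X k : MvPowerSeries σ R) := by
  refine ⟨fun h ↦ ?_, fun h ↦ ?_, fun f g h ↦ ?_⟩
  · have := congrArg (coeff (Finsupp.single k 1)) h
    simp at this
  · simpa using h.map (constantCoeff (σ := σ) (R := R))
  · simpa [X_dvd_iff_killVar_eq_zero] using h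

/-- Completeness of a power series ring along a variable. -/
lemma exists_X_pow_dvd_sub_sum (k : σ) (u : ℕ → MvPowerSeries σ R) :
    ∃ T : MvPowerSeries σ R, ∀ N, X k ^ N ∣ T - ∑ n ∈ Finset.range N, X k ^ n * u n := by
  obtain ⟨T, hT⟩ := exists_coeff_eq fun d ↦ coeff d (∑ n ∈ Finset.range (d k + 1), X k ^ n * u n)
  refine ⟨T, fun N ↦ ?_⟩
  rw [X_pow_dvd_iff]
  intro m hm
  rw [map_sub, sub_eq_zero, hT, map_sum, map_sum]
  refine Finset.sum_subset (by simpa using Nat.succ_le_of_lt hm) fun n _ hn ↦ ?_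
  exact X_pow_dvd_iff.mp (Dvd.intro _ rfl) m (by simpa using hn)

lemma eq_of_forall_X_pow_dvd_sub (k : σ) {f g : MvPowerSeries σ R}
    (h : ∀ N, X k ^ N ∣ f - g) : f = g := by
  ext d
  rw [← sub_eq_zero, ← map_sub]
  exact X_pow_dvd_iff.mp (h (d k + 1)) d (Nat.lt_succ_self _)

/-- Exactness of the Koszul complex can be checked after setting a variable to zero. -/
lemma KoszulExact.of_killVar [IsDomain R] (k : σ) {a b : MvPowerSeries σ R}
    (h : KoszulExact (killVar k a) (killVar k b)) : KoszulExact a b := by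
  have step (p : {p : MvPowerSeries σ R × MvPowerSeries σ R // a * p.1 = b * p.2}) :
      ∃ (t : MvPowerSeries σ R)
        (p' : {p : MvPowerSeries σ R × MvPowerSeries σ R // a * p.1 = b * p.2}),
        p.1.1 = b * t + X k * p'.1.1 ∧ p.1.2 = a * t + X k * p'.1.2 := by
    obtain ⟨⟨s, q⟩, hsq⟩ := p
    obtain ⟨t, hs, hq⟩ := h (killVar k s) (killVar k q) (by
      rw [← map_mul, ← map_mul]; exact congrArg _ hsq)
    obtain ⟨a', ha⟩ := X_dvd_sub_killVar k a
    obtain ⟨b', hb⟩ := X_dvd_sub_killVar k b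
    obtain ⟨s', hs'⟩ := X_dvd_sub_killVar k s
    obtain ⟨q', hq'⟩ := X_dvd_sub_killVar k q
    have hs1 : s = b * t + X k * (s' - b' * t) := by
      linear_combination hs' + hs - t * hb
    have hq1 : q = a * t + X k * (q' - a' * t) := by
      linear_combination hq' + hq - t * ha
    refine ⟨t, ⟨(s' - b' * t, q' - a' * t), ?_⟩, hs1, hq1⟩
    refine mul_left_cancel₀ (prime_X k).ne_zero ?_
    linear_combination hsq - a * hs1 + b * hq1
  choose t next hs hq using step
  intro s q hsq
  let p (n : ℕ) := next^[n] ⟨(s, q), hsq⟩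
  have hp (n : ℕ) : p (n + 1) = next (p n) := Function.iterate_succ_apply' _ _ _
  have partial_sums (N : ℕ) :
      s = b * ∑ n ∈ Finset.range N, X k ^ n * t (p n) + X k ^ N * (p N).1.1 ∧
      q = a * ∑ n ∈ Finset.range N, X k ^ n * t (p n) + X k ^ N * (p N).1.2 := by
    induction N with
    | zero => simp [p]
    | succ N ih =>
      rw [Finset.sum_range_succ, hp]
      constructor
      · linear_combination ih.1 + X k ^ N * hs (p N)
      · linear_combination ih.2 + X k ^ N * hq (p N)
  obtain ⟨T, hT⟩ := exists_X_pow_dvd_sub_sum k fun n ↦ t (p n)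
  refine ⟨T, eq_of_forall_X_pow_dvd_sub k fun N ↦ ?_, eq_of_forall_X_pow_dvd_sub k fun N ↦ ?_⟩
  all_goals obtain ⟨c, hc⟩ := hT N
  · exact ⟨(p N).1.1 - b * c, by linear_combination (partial_sums N).1 - b * hc⟩
  · exact ⟨(p N).1.2 - a * c, by linear_combination (partial_sums N).2 - a * hc⟩

lemma prime_natCast {p : ℕ} (hp : p.Prime) : Prime (p : MvPowerSeries σ ℤ) := by
  have : Fact p.Prime := ⟨hp⟩
  have key (f : MvPowerSeries σ ℤ) :
      (p : MvPowerSeries σ ℤ) ∣ f ↔ map (Int.castRingHom (ZMod p)) f = 0 := by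
    constructor
    · rintro ⟨g, rfl⟩
      ext d
      rw [← nsmul_eq_mul, coeff_map, map_nsmul]
      simp
    · intro h
      have hd (d : σ →₀ ℕ) : (p : ℤ) ∣ coeff d f := by
        have := congrArg (coeff d) h
        rw [coeff_map, map_zero] at this
        exact (ZMod.intCast_zmod_eq_zero_iff_dvd _ _).mp this
      choose g hg using hd
      obtain ⟨g', hg'⟩ := exists_coeff_eq g
      refine ⟨g', ?_⟩
      ext d
      rw [← nsmul_eq_mul, map_nsmul, nsmul_eq_mul, hg, hg']
  refine ⟨?_, ?_, fun f g h ↦ ?_⟩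
  · intro h
    have := congrArg (constantCoeff (σ := σ) (R := ℤ)) h
    rw [map_natCast, map_zero] at this
    exact hp.ne_zero (by exact_mod_cast this)
  · intro h
    have := h.map (constantCoeff (σ := σ) (R := ℤ))
    rw [map_natCast, Int.isUnit_iff_natAbs_eq, Int.natAbs_natCast] at this
    exact hp.one_lt.ne' this
  · rw [key, map_mul, mul_eq_zero] at h
    rwa [key, key]

lemma coeff_one_add_X_pow_sub_one (j : σ) {l : ℕ} (hl : 0 < l) :
    coeff (Finsupp.single j l) ((1 + X j : MvPowerSeries σ R) ^ l - 1) = 1 := by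
  classical
  rw [add_comm, add_pow, map_sub, map_sum, Finset.sum_eq_single l]
  · rw [coeff_one, if_neg (by simpa using hl.ne')]
    simp [coeff_X_pow]
  · intro i _ hi
    rw [one_pow, mul_one, ← nsmul_eq_mul', map_nsmul, coeff_X_pow, if_neg, nsmul_zero]
    exact fun h ↦ hi (Finsupp.single_injective j h).symm
  · simp

lemma koszulExact_natCast {m : ℕ} (hm : m ≠ 0) {f : MvPowerSeries σ ℤ} {d : σ →₀ ℕ}
    (hd : coeff d f = 1) : KoszulExact (m : MvPowerSeries σ ℤ) f := by
  induction m using induction_on_primes with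
  | zero => exact absurd rfl hm
  | one => simpa using KoszulExact.one_left f
  | prime_mul p m hp ih =>
    rw [Nat.cast_mul]
    refine .mul_left (.of_prime (prime_natCast hp) ?_) (ih (by rintro rfl; simp at hm))
    rintro ⟨g, rfl⟩
    rw [← nsmul_eq_mul, map_nsmul, nsmul_eq_mul] at hd
    have := Int.natAbs_dvd_natAbs.mpr (Dvd.intro _ hd)
    simp at this
    exact hp.one_lt.ne' this

lemma koszulExact_one_add_X_pow_sub_one {i j : σ} (hij : i ≠ j) {m l : ℕ} (hm : 0 < m)
    (hl : 0 < l) :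
    KoszulExact ((1 + X i : MvPowerSeries σ ℤ) ^ m - 1) ((1 + X j) ^ l - 1) := by
  have hc := coeff_one_add_X_pow_sub_one (R := ℤ) j hl
  have h := geom_sum_mul (1 + X i : MvPowerSeries σ ℤ) m
  rw [add_sub_cancel_left] at h
  rw [← h]
  refine .mul_left (.of_killVar i ?_) (.of_prime (prime_X i) ?_)
  · have : killVar i (∑ n ∈ Finset.range m, (1 + X i : MvPowerSeries σ ℤ) ^ n) = m := by
      simp [map_sum, killVar_X_self]
    rw [this, map_sub, map_pow, map_add, map_one, killVar_X_of_ne hij.symm]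
    exact koszulExact_natCast hm.ne' hc
  · rw [X_dvd_iff]
    intro hX
    rw [hX _ (by simp [hij])] at hc
    exact zero_ne_one hc

end MvPowerSeries

section Weights

open MvPowerSeries

variable {n : ℕ}

lemma Vwt_zero : Vwt (0 : Fin n → ℤ) = 1 := by simp [Vwt]

lemma Vwt_add (a b : Fin n → ℤ) : Vwt (a + b) = Vwt a * Vwt b := by
  simp [Vwt, zpow_add, Finset.prod_mul_distrib]

lemma coe_onePlusZ (i : Fin n) : (onePlusZ i : PS n) = 1 + X i := rfl

lemma Vwt_single_natCast (i : Fin n) (m : ℕ) :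
    Vwt (Pi.single i (m : ℤ)) = (1 + X i) ^ m := by
  rw [Vwt, Finset.prod_eq_single i]
  · simp [coe_onePlusZ]
  · intro k _ hk
    simp [Pi.single_eq_of_ne hk]
  · simp

lemma killVar_Vwt (k : Fin n) (a : Fin n → ℤ) :
    killVar k (Vwt a) = Vwt (Function.update a k 0) := by
  have h (i : Fin n) : Units.map (killVar (R := ℤ) k).toMonoidHom (onePlusZ i) ^ a i =
      onePlusZ i ^ Function.update a k 0 i := by
    rcases eq_or_ne i k with rfl | hik
    · have : Units.map (killVar (R := ℤ) i).toMonoidHom (onePlusZ i) = 1 := by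
        ext1
        simp [coe_onePlusZ, killVar_X_self]
      rw [this, one_zpow, Function.update_self, zpow_zero]
    · have : Units.map (killVar (R := ℤ) k).toMonoidHom (onePlusZ i) = onePlusZ i := by
        ext1
        simp [coe_onePlusZ, killVar_X_of_ne hik]
      rw [this, Function.update_of_ne hik]
  have := congrArg Units.val (map_prod (Units.map (killVar (R := ℤ) k).toMonoidHom)
    (fun i ↦ onePlusZ i ^ a i) Finset.univ)
  simp only [map_zpow, h] at this
  exact this

lemma not_isUnit_one_sub_Vwt (a : Fin n → ℤ) : ¬ IsUnit (1 - Vwt a) := by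
  intro h
  have h1 : Units.map (constantCoeff (σ := Fin n) (R := ℤ)).toMonoidHom
      (∏ i, onePlusZ i ^ a i) = 1 := by
    rw [map_prod]
    refine Finset.prod_eq_one fun i _ ↦ ?_
    have : Units.map (constantCoeff (σ := Fin n) (R := ℤ)).toMonoidHom (onePlusZ i) = 1 := by
      ext1
      simp [coe_onePlusZ]
    rw [map_zpow, this, one_zpow]
  have h2 : constantCoeff (Vwt a) = 1 := congrArg Units.val h1
  have := h.map (constantCoeff (σ := Fin n) (R := ℤ))
  simp [h2] at this

/-- Multiplication by `1 - Vwt w` kills `q` modulo `c` for a subgroup of weights `w`. -/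
lemma dvd_one_sub_Vwt_mul_of_combination {c q : PS n} {a b : Fin n → ℤ}
    (ha : c ∣ (1 - Vwt a) * q) (hb : c ∣ (1 - Vwt b) * q) (s t : ℤ) :
    c ∣ (1 - Vwt (s • a + t • b)) * q := by
  let H : AddSubgroup (Fin n → ℤ) :=
    { carrier := {w | c ∣ (1 - Vwt w) * q}
      zero_mem' := by simp [Vwt_zero]
      add_mem' := by
        intro x y hx hy
        have : (1 - Vwt (x + y)) * q = (1 - Vwt x) * q + Vwt x * ((1 - Vwt y) * q) := by
          rw [Vwt_add]; ring
        rw [Set.mem_ofPred_eq, this]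
        exact dvd_add hx (hy.mul_left _)
      neg_mem' := by
        intro x hx
        have h : Vwt (-x) * Vwt x = 1 := by rw [← Vwt_add, neg_add_cancel, Vwt_zero]
        have : (1 - Vwt (-x)) * q = -Vwt (-x) * ((1 - Vwt x) * q) := by
          linear_combination -q * h
        change c ∣ _
        rw [this]
        exact Dvd.dvd.mul_left hx _ }
  exact H.add_mem (H.zsmul_mem ha s) (H.zsmul_mem hb t)

lemma dvd_of_dvd_mul_of_combination {a b : Fin n → ℤ} (s t : ℤ)
    (h : KoszulExact (1 - Vwt a) (1 - Vwt (s • a + t • b))) {q : PS n}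
    (hq : 1 - Vwt a ∣ (1 - Vwt b) * q) : 1 - Vwt a ∣ q :=
  h.dvd_of_dvd_mul (dvd_one_sub_Vwt_mul_of_combination (Dvd.intro _ rfl) hq s t)

lemma koszulExact_one_sub_Vwt_of_triangular {i j : Fin n} (hij : i ≠ j) {a b : Fin n → ℤ}
    (hai : 0 < a i) (haj : a j = 0) (hbi : b i = 0) (hbj : 0 < b j) :
    KoszulExact (1 - Vwt a) (1 - Vwt b) := by
  suffices ∀ T : Finset (Fin n), ∀ a b : Fin n → ℤ, 0 < a i → a j = 0 → b i = 0 → 0 < b j →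
      (∀ k ∉ T, k ≠ i → k ≠ j → a k = 0 ∧ b k = 0) → KoszulExact (1 - Vwt a) (1 - Vwt b) from
    this Finset.univ a b hai haj hbi hbj (by simp)
  intro T
  induction T using Finset.induction_on with
  | empty =>
    intro a b hai haj hbi hbj h
    lift a i to ℕ using hai.le with m hm
    lift b j to ℕ using hbj.le with l hl
    have ha : a = Pi.single i (m : ℤ) := by
      ext k
      rcases eq_or_ne k i with rfl | hki
      · simp [hm]
      · rcases eq_or_ne k j with rfl | hkj
        · simp [haj, hki]
        · simp [(h k (by simp) hki hkj).1, hki]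
    have hb : b = Pi.single j (l : ℤ) := by
      ext k
      rcases eq_or_ne k j with rfl | hkj
      · simp [hl]
      · rcases eq_or_ne k i with rfl | hki
        · simp [hbi, hkj]
        · simp [(h k (by simp) hki hkj).2, hkj]
    rw [ha, hb, Vwt_single_natCast, Vwt_single_natCast, ← neg_sub, ← neg_sub (_ ^ l)]
    exact (koszulExact_one_add_X_pow_sub_one hij (by exact_mod_cast hai)
      (by exact_mod_cast hbj)).neg_left.symm.neg_left.symm
  | insert k T _ ih =>
    intro a b hai haj hbi hbj h
    by_cases hk : k = i ∨ k = j
    · exact ih a b hai haj hbi hbj fun k' hk' hi hj ↦ h k' (by grind) hi hj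
    · push Not at hk
      refine .of_killVar k ?_
      rw [map_sub, map_sub, map_one, killVar_Vwt, killVar_Vwt]
      refine ih _ _ ?_ ?_ ?_ ?_ fun k' hk' hi hj ↦ ?_
      · rwa [Function.update_of_ne hk.1.symm]
      · rwa [Function.update_of_ne hk.2.symm]
      · rwa [Function.update_of_ne hk.1.symm]
      · rwa [Function.update_of_ne hk.2.symm]
      · rcases eq_or_ne k' k with rfl | hkk
        · simp
        · rw [Function.update_of_ne hkk, Function.update_of_ne hkk]
          exact h k' (by simp [hkk, hk']) hi hj

lemma dvd_of_dvd_one_sub_Vwt_mul {i j : Fin n} {a b : Fin n → ℤ} (hai : a i ≠ 0)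
    (hab : a i * b j - a j * b i ≠ 0) {q : PS n} (hq : 1 - Vwt a ∣ (1 - Vwt b) * q) :
    1 - Vwt a ∣ q := by
  have hij : i ≠ j := by
    rintro rfl
    exact hab (by ring)
  set D := a i * b j - a j * b i with hD
  set b' : Fin n → ℤ := (-(D * b i)) • a + (D * a i) • b with hb'
  have hb'i : b' i = 0 := by simp [hb']; ring
  have hb'j : b' j = D ^ 2 := by simp [hb', hD]; ring
  set a' : Fin n → ℤ := (-(a i * a j)) • b' + (a i * D ^ 2) • a with ha'
  have ha'i : a' i = (a i * D) ^ 2 := by simp [ha', hb'i]; ring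
  have ha'j : a' j = 0 := by simp [ha', hb'j]; ring
  have h' : KoszulExact (1 - Vwt a') (1 - Vwt b') :=
    koszulExact_one_sub_Vwt_of_triangular hij (by rw [ha'i]; positivity) ha'j hb'i
      (by rw [hb'j]; positivity)
  have h : KoszulExact (1 - Vwt b') (1 - Vwt a) :=
    .of_dvd (h'.symm.left_ne_zero (not_isUnit_one_sub_Vwt a')) fun _ ↦
      dvd_of_dvd_mul_of_combination _ _ h'.symm
  exact dvd_of_dvd_mul_of_combination _ _ h.symm hq

lemma exists_minor_ne_zero {a b : Fin n → ℤ} (h : LinearIndependent ℤ ![a, b]) :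
    ∃ i j, a i ≠ 0 ∧ a i * b j - a j * b i ≠ 0 := by
  rw [LinearIndependent.pair_iff] at h
  by_contra! H
  obtain ⟨i, hi⟩ : ∃ i, a i ≠ 0 := by
    by_contra! h0
    have : a = 0 := funext h0
    exact one_ne_zero (h 1 0 (by simp [this])).1
  refine hi (h (-b i) (a i) ?_).2
  ext j
  have := H i j hi
  simp only [Pi.add_apply, Pi.smul_apply, smul_eq_mul, Pi.zero_apply]
  linarith

end Weights

theorem prod_euler_class_dvd (n : ℕ) (hn : 1 ≤ n) (P : PS n) (β : Fin n → Fin n → ℤ)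
    (hβ : LinearIndependent ℤ β) (hdvd : ∀ j, (1 - Vwt (β j)) ∣ P) :
    (∏ j, (1 - Vwt (β j))) ∣ P := by
  refine prod_dvd_of_pairwise_dvd_of_dvd_mul _ _ (fun i _ j _ hij q hq ↦ ?_) P fun j _ ↦ hdvd j
  have hpair : LinearIndependent ℤ ![β i, β j] := by
    have := hβ.comp ![i, j] (by
      intro x y hxy
      fin_cases x <;> fin_cases y <;> simp_all)
    convert this using 1
    ext x
    fin_cases x <;> rfl
  obtain ⟨k, l, hk, hkl⟩ := exists_minor_ne_zero hpair
  exact dvd_of_dvd_one_sub_Vwt_mul hk hkl hq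

end TMB
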